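/- Cut elimination for GT: if the sequent Γ ⇒ Δ is derivable in GT, then it is derivable in GT⁻ (the cut-free fragment of GT). -/

import Mathlib

/-! Basic propositional team logic PL(∨∨): syntax, team semantics,
resolutions, and the sequent calculi GT, G3cp, GT'. -/

/-- Valuations over a countably infinite set of propositional variables (ℕ). -/
abbrev Val : Type := ℕ → Bool

/-- A team is a set of valuations. -/
abbrev Team : Type := Set Val

/-- Formulas; PL(∨∨) formulas are the well-formed (`WF`) ones, in which
negation is applied only to classical formulas. `disj` is the split
disjunction ∨ and `idisj` the inquisitive disjunction ∨∨. -/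
inductive Form : Type where
  | var : ℕ → Form
  | bot : Form
  | neg : Form → Form
  | conj : Form → Form → Form
  | disj : Form → Form → Form
  | idisj : Form → Form → Form

namespace Form

/-- Classical (CPL) formulas: no inquisitive disjunction. -/
def IsClassical : Form → Prop
  | var _ => True
  | bot => True
  | neg α => IsClassical α
  | conj α β => IsClassical α ∧ IsClassical β
  | disj α β => IsClassical α ∧ IsClassical β
  | idisj _ _ => False

/-- Well-formed formulas = formulas of PL(∨∨): negation applies only to
classical formulas. -/
def WF : Form → Prop
  | var _ => True
  | bot => True
  | neg α => IsClassical α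
  | conj φ ψ => WF φ ∧ WF ψ
  | disj φ ψ => WF φ ∧ WF ψ
  | idisj φ ψ => WF φ ∧ WF ψ

/-- Team satisfaction. -/
def Sat : Form → Team → Prop
  | var p, t => ∀ v ∈ t, v p = true
  | bot, t => t = ∅
  | neg α, t => ∀ v ∈ t, ¬ Sat α {v}
  | conj φ ψ, t => Sat φ t ∧ Sat ψ t
  | disj φ ψ, t => ∃ s u : Team, t = s ∪ u ∧ Sat φ s ∧ Sat ψ u
  | idisj φ ψ, t => Sat φ t ∨ Sat ψ t

/-- Single-valuation (classical) satisfaction, for classical formulas. -/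
def CSat : Form → Val → Prop
  | var p, v => v p = true
  | bot, _ => False
  | neg α, v => ¬ CSat α v
  | conj α β, v => CSat α v ∧ CSat β v
  | disj α β, v => CSat α v ∨ CSat β v
  | idisj _ _, _ => False

/-- The set of resolutions of a formula. -/
def res : Form → Set Form
  | var p => {var p}
  | bot => {bot}
  | neg α => Form.neg '' res α
  | conj φ ψ => Set.image2 Form.conj (res φ) (res ψ)
  | disj φ ψ => Set.image2 Form.disj (res φ) (res ψ)
  | idisj φ ψ => res φ ∪ res ψ

/-- Propositional variables occurring in a formula. -/
def vars : Form → Set ℕ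
  | var p => {p}
  | bot => ∅
  | neg α => vars α
  | conj φ ψ => vars φ ∪ vars ψ
  | disj φ ψ => vars φ ∪ vars ψ
  | idisj φ ψ => vars φ ∪ vars ψ

/-- Signed occurrences: `svars φ true` = positively occurring variables,
`svars φ false` = negatively occurring variables. -/
def svars : Form → Bool → Set ℕ
  | var p, b => if b then {p} else ∅
  | bot, _ => ∅
  | neg α, b => svars α (!b)
  | conj φ ψ, b => svars φ b ∪ svars ψ b
  | disj φ ψ, b => svars φ b ∪ svars ψ b
  | idisj φ ψ, b => svars φ b ∪ svars ψ b

/-- Positively occurring variables P⁺(φ). -/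
def pvars (φ : Form) : Set ℕ := φ.svars true

/-- Negatively occurring variables P⁻(φ). -/
def nvars (φ : Form) : Set ℕ := φ.svars false

end Form

/-- `t ⊨ Γ`: every formula of the multiset Γ is satisfied by `t`. -/
def SatAll (t : Team) (Γ : Multiset Form) : Prop := ∀ φ ∈ Γ, Form.Sat φ t

/-- Team entailment Γ ⊨ φ. -/
def Entails (Γ : Multiset Form) (φ : Form) : Prop :=
  ∀ t : Team, SatAll t Γ → Form.Sat φ t

/-- Resolutions R(Γ) of a multiset of formulas: images of Γ under resolution
functions. -/
def mres (Γ : Multiset Form) : Set (Multiset Form) :=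
  {Ξ | ∃ f : Form → Form, (∀ φ ∈ Γ, f φ ∈ Form.res φ) ∧ Ξ = Γ.map f}

/-- Variables occurring in a multiset of formulas. -/
def mvars (Γ : Multiset Form) : Set ℕ := {p | ∃ φ ∈ Γ, p ∈ Form.vars φ}

/-- P⁺(Γ). -/
def mpvars (Γ : Multiset Form) : Set ℕ := {p | ∃ φ ∈ Γ, p ∈ Form.pvars φ}

/-- P⁻(Γ). -/
def mnvars (Γ : Multiset Form) : Set ℕ := {p | ∃ φ ∈ Γ, p ∈ Form.nvars φ}

/-- The split disjunction ⋁Δ of a multiset (⊥ for the empty multiset).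
(Satisfaction is invariant under the order of the chosen list.) -/
noncomputable def bigVee (Δ : Multiset Form) : Form :=
  Δ.toList.foldr Form.disj Form.bot

/-- One-hole formula contexts in which the hole does not occur in the scope
of a negation; these represent the subformula occurrences to which the
deep-inference rules may be applied. -/
inductive Ctx : Type where
  | hole : Ctx
  | conjL : Ctx → Form → Ctx
  | conjR : Form → Ctx → Ctx
  | disjL : Ctx → Form → Ctx
  | disjR : Form → Ctx → Ctx
  | idisjL : Ctx → Form → Ctx
  | idisjR : Form → Ctx → Ctx

/-- Plugging a formula into a context: χ{η}. -/
def Ctx.fill : Ctx → Form → Form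
  | .hole, η => η
  | .conjL c ψ, η => Form.conj (c.fill η) ψ
  | .conjR ψ c, η => Form.conj ψ (c.fill η)
  | .disjL c ψ, η => Form.disj (c.fill η) ψ
  | .disjR ψ c, η => Form.disj ψ (c.fill η)
  | .idisjL c ψ, η => Form.idisj (c.fill η) ψ
  | .idisjR ψ c, η => Form.idisj ψ (c.fill η)

/-- The sequent calculus GT. `GT c n Γ Δ` means: the sequent Γ ⇒ Δ has a
derivation of height at most `n`, using Cut only if `c = true`.
So `∃ n, GT true n Γ Δ` is derivability in GT, `∃ n, GT false n Γ Δ` is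
derivability in the cut-free fragment GT⁻, and `GT false n Γ Δ` is
`⊢ⁿ Γ ⇒ Δ` (cut-free derivability with height at most n). -/
inductive GT : Bool → ℕ → Multiset Form → Multiset Form → Prop
  | ax (c : Bool) (n : ℕ) (Γ Δ : Multiset Form) (p : ℕ) :
      GT c (n + 1) (Form.var p ::ₘ Γ) (Form.var p ::ₘ Δ)
  | lbot (c : Bool) (n : ℕ) (Γ Δ : Multiset Form) :
      GT c (n + 1) (Form.bot ::ₘ Γ) Δ
  | lneg (c : Bool) (n : ℕ) (Γ Δ : Multiset Form) (α : Form) :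
      Form.IsClassical α → GT c n Γ (α ::ₘ Δ) →
      GT c (n + 1) (Form.neg α ::ₘ Γ) Δ
  | rneg (c : Bool) (n : ℕ) (Γ Δ : Multiset Form) (α : Form) :
      Form.IsClassical α → GT c n (α ::ₘ Γ) Δ →
      GT c (n + 1) Γ (Form.neg α ::ₘ Δ)
  | lconj (c : Bool) (n : ℕ) (Γ Δ : Multiset Form) (φ ψ : Form) :
      GT c n (φ ::ₘ ψ ::ₘ Γ) Δ →
      GT c (n + 1) (Form.conj φ ψ ::ₘ Γ) Δ
  | rconj (c : Bool) (n : ℕ) (Γ Λ Δ : Multiset Form) (φ ψ : Form) :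
      (∀ γ ∈ Λ, Form.IsClassical γ) →
      GT c n Γ (φ ::ₘ Λ) → GT c n Γ (ψ ::ₘ Λ) →
      GT c (n + 1) Γ (Form.conj φ ψ ::ₘ (Λ + Δ))
  | ldisj (c : Bool) (n : ℕ) (Γ Λ Δ : Multiset Form) (φ ψ : Form) :
      (∀ γ ∈ Λ, Form.IsClassical γ) →
      GT c n (φ ::ₘ Γ) Λ → GT c n (ψ ::ₘ Γ) Λ →
      GT c (n + 1) (Form.disj φ ψ ::ₘ Γ) (Λ + Δ)
  | rdisj (c : Bool) (n : ℕ) (Γ Δ : Multiset Form) (φ ψ : Form) :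
      GT c n Γ (φ ::ₘ ψ ::ₘ Δ) →
      GT c (n + 1) Γ (Form.disj φ ψ ::ₘ Δ)
  | lidisj (c : Bool) (n : ℕ) (Γ Δ : Multiset Form) (χ : Ctx) (φL φR : Form) :
      GT c n (χ.fill φL ::ₘ Γ) Δ → GT c n (χ.fill φR ::ₘ Γ) Δ →
      GT c (n + 1) (χ.fill (Form.idisj φL φR) ::ₘ Γ) Δ
  | ridisjL (c : Bool) (n : ℕ) (Γ Δ : Multiset Form) (χ : Ctx) (φL φR : Form) :
      GT c n Γ (χ.fill φL ::ₘ Δ) →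
      GT c (n + 1) Γ (χ.fill (Form.idisj φL φR) ::ₘ Δ)
  | ridisjR (c : Bool) (n : ℕ) (Γ Δ : Multiset Form) (χ : Ctx) (φL φR : Form) :
      GT c n Γ (χ.fill φR ::ₘ Δ) →
      GT c (n + 1) Γ (χ.fill (Form.idisj φL φR) ::ₘ Δ)
  | cut (n : ℕ) (Γ Δ Θ S : Multiset Form) (φ : Form) :
      GT true n Γ (φ ::ₘ Δ) → GT true n (φ ::ₘ Θ) S →
      GT true (n + 1) (Γ + Θ) (Δ + S)

/-- The classical sequent calculus G3cp (on classical formulas).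
`G3 false` is its cut-free fragment G3cp⁻. -/
inductive G3 : Bool → Multiset Form → Multiset Form → Prop
  | ax (c : Bool) (Γ Δ : Multiset Form) (p : ℕ) :
      (∀ α ∈ Γ, Form.IsClassical α) → (∀ α ∈ Δ, Form.IsClassical α) →
      G3 c (Form.var p ::ₘ Γ) (Form.var p ::ₘ Δ)
  | lbot (c : Bool) (Γ Δ : Multiset Form) :
      (∀ α ∈ Γ, Form.IsClassical α) → (∀ α ∈ Δ, Form.IsClassical α) →
      G3 c (Form.bot ::ₘ Γ) Δ
  | lneg (c : Bool) (Γ Δ : Multiset Form) (α : Form) :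
      Form.IsClassical α → G3 c Γ (α ::ₘ Δ) → G3 c (Form.neg α ::ₘ Γ) Δ
  | rneg (c : Bool) (Γ Δ : Multiset Form) (α : Form) :
      Form.IsClassical α → G3 c (α ::ₘ Γ) Δ → G3 c Γ (Form.neg α ::ₘ Δ)
  | lconj (c : Bool) (Γ Δ : Multiset Form) (α β : Form) :
      G3 c (α ::ₘ β ::ₘ Γ) Δ → G3 c (Form.conj α β ::ₘ Γ) Δ
  | rconj (c : Bool) (Γ Λ Δ : Multiset Form) (α β : Form) :
      (∀ γ ∈ Λ, Form.IsClassical γ) → (∀ γ ∈ Δ, Form.IsClassical γ) →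
      G3 c Γ (α ::ₘ Λ) → G3 c Γ (β ::ₘ Λ) →
      G3 c Γ (Form.conj α β ::ₘ (Λ + Δ))
  | ldisj (c : Bool) (Γ Λ Δ : Multiset Form) (α β : Form) :
      (∀ γ ∈ Λ, Form.IsClassical γ) → (∀ γ ∈ Δ, Form.IsClassical γ) →
      G3 c (α ::ₘ Γ) Λ → G3 c (β ::ₘ Γ) Λ →
      G3 c (Form.disj α β ::ₘ Γ) (Λ + Δ)
  | rdisj (c : Bool) (Γ Δ : Multiset Form) (α β : Form) :
      G3 c Γ (α ::ₘ β ::ₘ Δ) → G3 c Γ (Form.disj α β ::ₘ Δ)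
  | cut (Γ Δ Θ S : Multiset Form) (α : Form) :
      Form.IsClassical α →
      G3 true Γ (α ::ₘ Δ) → G3 true (α ::ₘ Θ) S →
      G3 true (Γ + Θ) (Δ + S)

/-- The cut-free variant calculus GT'⁻: GT⁻ with independent-context rules
R∧', L∨' in place of R∧, L∨, plus explicit contraction rules LC and RC
(RC restricted to classical formulas). -/
inductive GTp : Multiset Form → Multiset Form → Prop
  | ax (Γ Δ : Multiset Form) (p : ℕ) :
      GTp (Form.var p ::ₘ Γ) (Form.var p ::ₘ Δ)
  | lbot (Γ Δ : Multiset Form) : GTp (Form.bot ::ₘ Γ) Δ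
  | lneg (Γ Δ : Multiset Form) (α : Form) :
      Form.IsClassical α → GTp Γ (α ::ₘ Δ) → GTp (Form.neg α ::ₘ Γ) Δ
  | rneg (Γ Δ : Multiset Form) (α : Form) :
      Form.IsClassical α → GTp (α ::ₘ Γ) Δ → GTp Γ (Form.neg α ::ₘ Δ)
  | lconj (Γ Δ : Multiset Form) (φ ψ : Form) :
      GTp (φ ::ₘ ψ ::ₘ Γ) Δ → GTp (Form.conj φ ψ ::ₘ Γ) Δ
  | rconj (Γ₁ Γ₂ Δ₁ Δ₂ : Multiset Form) (φ ψ : Form) :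
      GTp Γ₁ (φ ::ₘ Δ₁) → GTp Γ₂ (ψ ::ₘ Δ₂) →
      GTp (Γ₁ + Γ₂) (Form.conj φ ψ ::ₘ (Δ₁ + Δ₂))
  | ldisj (Γ₁ Γ₂ Δ₁ Δ₂ : Multiset Form) (φ ψ : Form) :
      GTp (φ ::ₘ Γ₁) Δ₁ → GTp (ψ ::ₘ Γ₂) Δ₂ →
      GTp (Form.disj φ ψ ::ₘ (Γ₁ + Γ₂)) (Δ₁ + Δ₂)
  | rdisj (Γ Δ : Multiset Form) (φ ψ : Form) :
      GTp Γ (φ ::ₘ ψ ::ₘ Δ) → GTp Γ (Form.disj φ ψ ::ₘ Δ)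
  | lidisj (Γ Δ : Multiset Form) (χ : Ctx) (φL φR : Form) :
      GTp (χ.fill φL ::ₘ Γ) Δ → GTp (χ.fill φR ::ₘ Γ) Δ →
      GTp (χ.fill (Form.idisj φL φR) ::ₘ Γ) Δ
  | ridisjL (Γ Δ : Multiset Form) (χ : Ctx) (φL φR : Form) :
      GTp Γ (χ.fill φL ::ₘ Δ) → GTp Γ (χ.fill (Form.idisj φL φR) ::ₘ Δ)
  | ridisjR (Γ Δ : Multiset Form) (χ : Ctx) (φL φR : Form) :
      GTp Γ (χ.fill φR ::ₘ Δ) → GTp Γ (χ.fill (Form.idisj φL φR) ::ₘ Δ)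
  | lc (Γ Δ : Multiset Form) (φ : Form) :
      GTp (φ ::ₘ φ ::ₘ Γ) Δ → GTp (φ ::ₘ Γ) Δ
  | rc (Γ Δ : Multiset Form) (α : Form) :
      Form.IsClassical α → GTp Γ (α ::ₘ α ::ₘ Δ) → GTp Γ (α ::ₘ Δ)

namespace Form

theorem Sat.mono {φ : Form} {s t : Team} (h : Sat φ t) (hst : s ⊆ t) : Sat φ s := by
  induction φ generalizing s t with
  | var p => exact fun v hv => h v (hst hv)
  | bot =>
    have ht : t = ∅ := h
    subst ht
    exact Set.subset_empty_iff.mp hst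
  | neg α _ => exact fun v hv => h v (hst hv)
  | conj φ ψ ihφ ihψ => exact ⟨ihφ h.1 hst, ihψ h.2 hst⟩
  | disj φ ψ ihφ ihψ =>
    obtain ⟨a, b, rfl, ha, hb⟩ := h
    refine ⟨s ∩ a, s ∩ b, ?_, ihφ ha Set.inter_subset_right, ihψ hb Set.inter_subset_right⟩
    rw [← Set.inter_union_distrib_left, Set.inter_eq_left.mpr hst]
  | idisj φ ψ ihφ ihψ => exact h.imp (ihφ · hst) (ihψ · hst)

theorem sat_empty (φ : Form) : Sat φ ∅ := by
  induction φ with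
  | var p => simp [Sat]
  | bot => rfl
  | neg α _ => simp [Sat]
  | conj φ ψ ihφ ihψ => exact ⟨ihφ, ihψ⟩
  | disj φ ψ ihφ ihψ => exact ⟨∅, ∅, by simp, ihφ, ihψ⟩
  | idisj φ ψ ihφ _ => exact Or.inl ihφ

/-- Classical formulas are flat. -/
theorem IsClassical.sat_iff {α : Form} (hα : IsClassical α) (t : Team) :
    Sat α t ↔ ∀ v ∈ t, CSat α v := by
  induction α generalizing t with
  | var p => rfl
  | bot => simp [Sat, CSat, Set.eq_empty_iff_forall_notMem]
  | neg α ih => simp [Sat, CSat, ih hα]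
  | conj α β ihα ihβ => simp [Sat, CSat, ihα hα.1, ihβ hα.2, forall_and]
  | disj α β ihα ihβ =>
    simp only [Sat, CSat, ihα hα.1, ihβ hα.2]
    constructor
    · rintro ⟨s, u, rfl, hs, hu⟩ v (hv | hv)
      exacts [Or.inl (hs v hv), Or.inr (hu v hv)]
    · intro h
      refine ⟨{v ∈ t | CSat α v}, {v ∈ t | CSat β v}, ?_, fun v hv => hv.2, fun v hv => hv.2⟩
      ext v
      simpa [← and_or_left] using h v
  | idisj φ ψ _ _ => exact hα.elim

theorem sat_fill_idisj (χ : Ctx) (φ ψ : Form) (t : Team) :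
    Sat (χ.fill (idisj φ ψ)) t ↔ Sat (χ.fill φ) t ∨ Sat (χ.fill ψ) t := by
  induction χ generalizing t with
  | hole => rfl
  | conjL χ θ ih => simp only [Ctx.fill, Sat, ih, or_and_right]
  | conjR θ χ ih => simp only [Ctx.fill, Sat, ih, and_or_left]
  | disjL χ θ ih => simp only [Ctx.fill, Sat, ih, or_and_right, and_or_left, exists_or]
  | disjR θ χ ih => simp only [Ctx.fill, Sat, ih, and_or_left, exists_or]
  | idisjL χ θ ih => rw [Ctx.fill, Sat, ih, or_or_distrib_right]; rfl
  | idisjR θ χ ih => rw [Ctx.fill, Sat, ih, or_or_distrib_left]; rfl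

theorem sizeOf_fill_lt (χ : Ctx) {φ ψ : Form} (h : sizeOf φ < sizeOf ψ) :
    sizeOf (χ.fill φ) < sizeOf (χ.fill ψ) := by
  induction χ <;> simp only [Ctx.fill, conj.sizeOf_spec, disj.sizeOf_spec, idisj.sizeOf_spec] <;>
    omega

theorem wf_fill_idisj {χ : Ctx} {φ ψ : Form} (h : WF (χ.fill (idisj φ ψ))) :
    WF (χ.fill φ) ∧ WF (χ.fill ψ) := by
  induction χ with
  | hole => exact h
  | conjL χ θ ih | disjL χ θ ih | idisjL χ θ ih =>
    exact ⟨⟨(ih h.1).1, h.2⟩, ⟨(ih h.1).2, h.2⟩⟩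
  | conjR θ χ ih | disjR θ χ ih | idisjR θ χ ih =>
    exact ⟨⟨h.1, (ih h.2).1⟩, ⟨h.1, (ih h.2).2⟩⟩

/-- A nonclassical PL(∨∨) formula has an inquisitive disjunction outside the scope of negations. -/
theorem WF.exists_fill_idisj {φ : Form} (h : WF φ) (hc : ¬ IsClassical φ) :
    ∃ (χ : Ctx) (ψ θ : Form), φ = χ.fill (idisj ψ θ) := by
  induction φ with
  | var p => exact (hc trivial).elim
  | bot => exact (hc trivial).elim
  | neg α _ => exact (hc h).elim
  | conj φ ψ ihφ ihψ =>
    by_cases hφ : IsClassical φ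
    · obtain ⟨χ, a, b, rfl⟩ := ihψ h.2 fun hψ => hc ⟨hφ, hψ⟩
      exact ⟨.conjR φ χ, a, b, rfl⟩
    · obtain ⟨χ, a, b, rfl⟩ := ihφ h.1 hφ
      exact ⟨.conjL χ ψ, a, b, rfl⟩
  | disj φ ψ ihφ ihψ =>
    by_cases hφ : IsClassical φ
    · obtain ⟨χ, a, b, rfl⟩ := ihψ h.2 fun hψ => hc ⟨hφ, hψ⟩
      exact ⟨.disjR φ χ, a, b, rfl⟩
    · obtain ⟨χ, a, b, rfl⟩ := ihφ h.1 hφ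
      exact ⟨.disjL χ ψ, a, b, rfl⟩
  | idisj φ ψ _ _ => exact ⟨.hole, φ, ψ, rfl⟩

end Form

theorem SatAll.mono {Γ : Multiset Form} {s t : Team} (h : SatAll t Γ) (hst : s ⊆ t) :
    SatAll s Γ :=
  fun φ hφ => (h φ hφ).mono hst

theorem satAll_cons {φ : Form} {Γ : Multiset Form} {t : Team} :
    SatAll t (φ ::ₘ Γ) ↔ Form.Sat φ t ∧ SatAll t Γ := by
  simp [SatAll]

instance : LeftCommutative
    (fun (φ : Form) (P : Team → Prop) (t : Team) => ∃ s u, t = s ∪ u ∧ Form.Sat φ s ∧ P u) where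
  left_comm φ ψ P := by
    funext t
    apply propext
    constructor <;>
    · rintro ⟨s, _, rfl, hs, u, w, rfl, hu, hw⟩
      exact ⟨u, s ∪ w, Set.union_left_comm s u w, hu, s, w, rfl, hs, hw⟩

/-- `SplitSat Δ t`: the team `t` satisfies the split disjunction of the multiset `Δ`. -/
def SplitSat (Δ : Multiset Form) : Team → Prop :=
  Δ.foldr (fun φ P t => ∃ s u, t = s ∪ u ∧ Form.Sat φ s ∧ P u) (· = ∅)

theorem splitSat_zero {t : Team} : SplitSat 0 t ↔ t = ∅ := by
  simp [SplitSat]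

theorem splitSat_cons {φ : Form} {Δ : Multiset Form} {t : Team} :
    SplitSat (φ ::ₘ Δ) t ↔ ∃ s u, t = s ∪ u ∧ Form.Sat φ s ∧ SplitSat Δ u := by
  simp [SplitSat]

theorem splitSat_empty (Δ : Multiset Form) : SplitSat Δ ∅ := by
  induction Δ using Multiset.induction with
  | empty => exact splitSat_zero.mpr rfl
  | cons φ Δ ih => exact splitSat_cons.mpr ⟨∅, ∅, by simp, φ.sat_empty, ih⟩

theorem SplitSat.mono {Δ : Multiset Form} {s t : Team} (h : SplitSat Δ t) (hst : s ⊆ t) :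
    SplitSat Δ s := by
  induction Δ using Multiset.induction generalizing s t with
  | empty =>
    rw [splitSat_zero] at h ⊢
    subst h
    exact Set.subset_empty_iff.mp hst
  | cons φ Δ ih =>
    obtain ⟨a, b, rfl, ha, hb⟩ := splitSat_cons.mp h
    refine splitSat_cons.mpr
      ⟨s ∩ a, s ∩ b, ?_, ha.mono Set.inter_subset_right, ih hb Set.inter_subset_right⟩
    rw [← Set.inter_union_distrib_left, Set.inter_eq_left.mpr hst]

theorem SplitSat.union_add {Δ Λ : Multiset Form} {s t : Team} (hs : SplitSat Δ s)
    (ht : SplitSat Λ t) : SplitSat (Δ + Λ) (s ∪ t) := by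
  induction Δ using Multiset.induction generalizing s with
  | empty =>
    rw [splitSat_zero] at hs
    subst hs
    simpa using ht
  | cons φ Δ ih =>
    obtain ⟨a, b, rfl, ha, hb⟩ := splitSat_cons.mp hs
    rw [Multiset.cons_add, Set.union_assoc]
    exact splitSat_cons.mpr ⟨a, b ∪ t, rfl, ha, ih hb⟩

theorem SplitSat.add_right {Λ : Multiset Form} {t : Team} (h : SplitSat Λ t) (Δ : Multiset Form) :
    SplitSat (Λ + Δ) t := by
  simpa using h.union_add (splitSat_empty Δ)

theorem splitSat_iff_of_isClassical {Λ : Multiset Form} (hΛ : ∀ γ ∈ Λ, Form.IsClassical γ)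
    (t : Team) : SplitSat Λ t ↔ ∀ v ∈ t, ∃ γ ∈ Λ, Form.CSat γ v := by
  induction Λ using Multiset.induction generalizing t with
  | empty => simp [splitSat_zero, Set.eq_empty_iff_forall_notMem]
  | cons α Λ ih =>
    rw [Multiset.forall_mem_cons] at hΛ
    simp only [splitSat_cons, hΛ.1.sat_iff, ih hΛ.2, Multiset.mem_cons, exists_eq_or_imp]
    constructor
    · rintro ⟨s, u, rfl, hs, hu⟩ v (hv | hv)
      exacts [Or.inl (hs v hv), Or.inr (hu v hv)]
    · intro h
      refine ⟨{v ∈ t | Form.CSat α v}, {v ∈ t | ∃ γ ∈ Λ, Form.CSat γ v}, ?_,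
        fun v hv => hv.2, fun v hv => hv.2⟩
      ext v
      simpa [← and_or_left] using h v

theorem SplitSat.union {Λ : Multiset Form} (hΛ : ∀ γ ∈ Λ, Form.IsClassical γ) {s t : Team}
    (hs : SplitSat Λ s) (ht : SplitSat Λ t) : SplitSat Λ (s ∪ t) := by
  rw [splitSat_iff_of_isClassical hΛ] at hs ht ⊢
  rintro v (hv | hv)
  exacts [hs v hv, ht v hv]

theorem splitSat_fill_idisj {χ : Ctx} {φ ψ : Form} {Δ : Multiset Form} {t : Team} :
    SplitSat (χ.fill (Form.idisj φ ψ) ::ₘ Δ) t ↔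
      SplitSat (χ.fill φ ::ₘ Δ) t ∨ SplitSat (χ.fill ψ ::ₘ Δ) t := by
  simp only [splitSat_cons, Form.sat_fill_idisj, or_and_right, and_or_left, exists_or]

/-- A sequent is valid if every team satisfying its antecedent satisfies the split disjunction
of its succedent. -/
def SequentValid (Γ Δ : Multiset Form) : Prop := ∀ t : Team, SatAll t Γ → SplitSat Δ t

theorem GT.sound {c : Bool} {n : ℕ} {Γ Δ : Multiset Form} (h : GT c n Γ Δ) :
    SequentValid Γ Δ := by
  induction h with
  | ax c n Γ Δ p =>
    intro t ht
    exact splitSat_cons.mpr ⟨t, ∅, by simp, (satAll_cons.mp ht).1, splitSat_empty Δ⟩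
  | lbot c n Γ Δ =>
    intro t ht
    have : t = ∅ := (satAll_cons.mp ht).1
    exact this ▸ splitSat_empty Δ
  | lneg c n Γ Δ α hα _ ih =>
    intro t ht
    obtain ⟨hneg, hΓ⟩ := satAll_cons.mp ht
    obtain ⟨s, u, rfl, hs, hu⟩ := splitSat_cons.mp (ih t hΓ)
    have hs0 : s = ∅ := Set.eq_empty_of_forall_notMem fun v hv =>
      hneg v (Or.inl hv) (hs.mono (Set.singleton_subset_iff.mpr hv))
    simpa [hs0] using hu
  | rneg c n Γ Δ α hα _ ih =>
    intro t ht
    have hu := ih {v ∈ t | Form.CSat α v}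
      (satAll_cons.mpr ⟨(hα.sat_iff _).mpr fun v hv => hv.2, ht.mono (Set.sep_subset _ _)⟩)
    refine splitSat_cons.mpr ⟨{v ∈ t | ¬ Form.CSat α v}, _, ?_, ?_, hu⟩
    · ext v
      by_cases hv : Form.CSat α v <;> simp [hv]
    · exact (Form.IsClassical.sat_iff (α := Form.neg α) hα _).mpr fun v hv => hv.2
  | lconj c n Γ Δ φ ψ _ ih =>
    intro t ht
    obtain ⟨⟨hφ, hψ⟩, hΓ⟩ := satAll_cons.mp ht
    exact ih t (satAll_cons.mpr ⟨hφ, satAll_cons.mpr ⟨hψ, hΓ⟩⟩)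
  | rconj c n Γ Λ Δ φ ψ hΛ _ _ ihφ ihψ =>
    intro t ht
    obtain ⟨s, u, hsu, hs, hu⟩ := splitSat_cons.mp (ihφ t ht)
    obtain ⟨s', u', hsu', hs', hu'⟩ := splitSat_cons.mp (ihψ t ht)
    have hconj : Form.Sat (φ.conj ψ) (s ∩ s') :=
      ⟨hs.mono Set.inter_subset_left, hs'.mono Set.inter_subset_right⟩
    have hrest : SplitSat Λ (t ∩ (u ∪ u')) :=
      (hu.union hΛ hu').mono Set.inter_subset_right
    rw [← Multiset.cons_add]
    refine (splitSat_cons.mpr ⟨s ∩ s', t ∩ (u ∪ u'), ?_, hconj, hrest⟩).add_right Δ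
    ext v
    have h1 : v ∈ t ↔ v ∈ s ∨ v ∈ u := by rw [hsu]; rfl
    have h2 : v ∈ t ↔ v ∈ s' ∨ v ∈ u' := by rw [hsu']; rfl
    simp only [Set.mem_union, Set.mem_inter_iff]
    tauto
  | ldisj c n Γ Λ Δ φ ψ hΛ _ _ ihφ ihψ =>
    intro t ht
    obtain ⟨⟨s, u, rfl, hs, hu⟩, hΓ⟩ := satAll_cons.mp ht
    exact ((ihφ s (satAll_cons.mpr ⟨hs, hΓ.mono Set.subset_union_left⟩)).union hΛ
      (ihψ u (satAll_cons.mpr ⟨hu, hΓ.mono Set.subset_union_right⟩))).add_right Δ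
  | rdisj c n Γ Δ φ ψ _ ih =>
    intro t ht
    obtain ⟨s, _, rfl, hs, hr⟩ := splitSat_cons.mp (ih t ht)
    obtain ⟨u, w, rfl, hu, hw⟩ := splitSat_cons.mp hr
    exact splitSat_cons.mpr ⟨s ∪ u, w, (Set.union_assoc s u w).symm, ⟨s, u, rfl, hs, hu⟩, hw⟩
  | lidisj c n Γ Δ χ φL φR _ _ ihL ihR =>
    intro t ht
    obtain ⟨hχ, hΓ⟩ := satAll_cons.mp ht
    rcases (Form.sat_fill_idisj χ φL φR t).mp hχ with h | h
    exacts [ihL t (satAll_cons.mpr ⟨h, hΓ⟩), ihR t (satAll_cons.mpr ⟨h, hΓ⟩)]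
  | ridisjL c n Γ Δ χ φL φR _ ih =>
    exact fun t ht => splitSat_fill_idisj.mpr (Or.inl (ih t ht))
  | ridisjR c n Γ Δ χ φL φR _ ih =>
    exact fun t ht => splitSat_fill_idisj.mpr (Or.inr (ih t ht))
  | cut n Γ Δ Θ S φ _ _ ihl ihr =>
    intro t ht
    have hΓ : SatAll t Γ := fun γ hγ => ht γ (Multiset.mem_add.mpr (Or.inl hγ))
    have hΘ : SatAll t Θ := fun γ hγ => ht γ (Multiset.mem_add.mpr (Or.inr hγ))
    obtain ⟨s, u, rfl, hs, hu⟩ := splitSat_cons.mp (ihl t hΓ)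
    rw [Set.union_comm]
    exact hu.union_add (ihr s (satAll_cons.mpr ⟨hs, hΘ.mono Set.subset_union_left⟩))

theorem GT.succ {c : Bool} {n : ℕ} {Γ Δ : Multiset Form} (h : GT c n Γ Δ) :
    GT c (n + 1) Γ Δ := by
  induction h with
  | ax c n Γ Δ p => exact .ax c _ Γ Δ p
  | lbot c n Γ Δ => exact .lbot c _ Γ Δ
  | lneg c n Γ Δ α hα _ ih => exact .lneg c _ Γ Δ α hα ih
  | rneg c n Γ Δ α hα _ ih => exact .rneg c _ Γ Δ α hα ih
  | lconj c n Γ Δ φ ψ _ ih => exact .lconj c _ Γ Δ φ ψ ih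
  | rconj c n Γ Λ Δ φ ψ hΛ _ _ ihφ ihψ => exact .rconj c _ Γ Λ Δ φ ψ hΛ ihφ ihψ
  | ldisj c n Γ Λ Δ φ ψ hΛ _ _ ihφ ihψ => exact .ldisj c _ Γ Λ Δ φ ψ hΛ ihφ ihψ
  | rdisj c n Γ Δ φ ψ _ ih => exact .rdisj c _ Γ Δ φ ψ ih
  | lidisj c n Γ Δ χ φL φR _ _ ihL ihR => exact .lidisj c _ Γ Δ χ φL φR ihL ihR
  | ridisjL c n Γ Δ χ φL φR _ ih => exact .ridisjL c _ Γ Δ χ φL φR ih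
  | ridisjR c n Γ Δ χ φL φR _ ih => exact .ridisjR c _ Γ Δ χ φL φR ih
  | cut n Γ Δ Θ S φ _ _ ihl ihr => exact .cut _ Γ Δ Θ S φ ihl ihr

theorem GT.of_le {c : Bool} {m n : ℕ} {Γ Δ : Multiset Form} (h : GT c m Γ Δ) (hmn : m ≤ n) :
    GT c n Γ Δ := by
  induction hmn with
  | refl => exact h
  | step _ ih => exact ih.succ

/-- Two derivable sequents have derivations within a common height bound. -/
theorem GT.exists_common_height {c : Bool} {Γ Δ Γ' Δ' : Multiset Form}
    (h : ∃ n, GT c n Γ Δ) (h' : ∃ n, GT c n Γ' Δ') : ∃ n, GT c n Γ Δ ∧ GT c n Γ' Δ' := by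
  obtain ⟨m, hm⟩ := h
  obtain ⟨n, hn⟩ := h'
  exact ⟨max m n, hm.of_le (le_max_left m n), hn.of_le (le_max_right m n)⟩

/-- Total size of the formulas in a multiset. -/
noncomputable def msize (Γ : Multiset Form) : ℕ := (Γ.map sizeOf).sum

@[simp]
theorem msize_cons (φ : Form) (Γ : Multiset Form) : msize (φ ::ₘ Γ) = sizeOf φ + msize Γ := by
  simp [msize]

/-- Cut-free completeness for classical sequents. -/
theorem GT.complete_of_isClassical (Γ Δ : Multiset Form)
    (hΓ : ∀ γ ∈ Γ, Form.IsClassical γ) (hΔ : ∀ δ ∈ Δ, Form.IsClassical δ)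
    (h : ∀ v, (∀ γ ∈ Γ, Form.CSat γ v) → ∃ δ ∈ Δ, Form.CSat δ v) :
    ∃ n, GT false n Γ Δ := by
  by_cases hL : ∃ φ ∈ Γ, ∀ p, φ ≠ Form.var p
  · obtain ⟨φ, hφ, hvar⟩ := hL
    obtain ⟨Γ, rfl⟩ := Multiset.exists_cons_of_mem hφ
    rw [Multiset.forall_mem_cons] at hΓ
    simp only [Multiset.forall_mem_cons] at h
    cases φ with
    | var p => exact (hvar p rfl).elim
    | bot => exact ⟨1, .lbot _ _ _ _⟩
    | neg α =>
      have hα : Form.IsClassical α := hΓ.1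
      obtain ⟨n, hn⟩ := complete_of_isClassical Γ (α ::ₘ Δ) hΓ.2 (by simpa [hα] using hΔ) <| by
        intro v hv
        by_cases hc : Form.CSat α v
        · exact ⟨α, by simp, hc⟩
        · obtain ⟨δ, hδ, hv'⟩ := h v ⟨hc, hv⟩
          exact ⟨δ, Multiset.mem_cons_of_mem hδ, hv'⟩
      exact ⟨n + 1, .lneg _ _ _ _ _ hα hn⟩
    | conj α β =>
      obtain ⟨n, hn⟩ := complete_of_isClassical (α ::ₘ β ::ₘ Γ) Δ
        (by simp only [Multiset.forall_mem_cons]; exact ⟨hΓ.1.1, hΓ.1.2, hΓ.2⟩) hΔ <| by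
        simp only [Multiset.forall_mem_cons]
        exact fun v hv => h v ⟨⟨hv.1, hv.2.1⟩, hv.2.2⟩
      exact ⟨n + 1, .lconj _ _ _ _ _ _ hn⟩
    | disj α β =>
      obtain ⟨n, hα, hβ⟩ := GT.exists_common_height
        (complete_of_isClassical (α ::ₘ Γ) Δ
          (by simp only [Multiset.forall_mem_cons]; exact ⟨hΓ.1.1, hΓ.2⟩) hΔ <| by
          simp only [Multiset.forall_mem_cons]
          exact fun v hv => h v ⟨Or.inl hv.1, hv.2⟩)
        (complete_of_isClassical (β ::ₘ Γ) Δ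
          (by simp only [Multiset.forall_mem_cons]; exact ⟨hΓ.1.2, hΓ.2⟩) hΔ <| by
          simp only [Multiset.forall_mem_cons]
          exact fun v hv => h v ⟨Or.inr hv.1, hv.2⟩)
      exact ⟨n + 1, by simpa using GT.ldisj _ _ _ _ 0 _ _ hΔ hα hβ⟩
    | idisj φ ψ => exact hΓ.1.elim
  by_cases hR : ∃ φ ∈ Δ, φ ≠ Form.bot ∧ ∀ p, φ ≠ Form.var p
  · obtain ⟨φ, hφ, hbot, hvar⟩ := hR
    obtain ⟨Δ, rfl⟩ := Multiset.exists_cons_of_mem hφ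
    rw [Multiset.forall_mem_cons] at hΔ
    simp only [Multiset.mem_cons, exists_eq_or_imp] at h
    cases φ with
    | var p => exact (hvar p rfl).elim
    | bot => exact (hbot rfl).elim
    | neg α =>
      have hα : Form.IsClassical α := hΔ.1
      obtain ⟨n, hn⟩ := complete_of_isClassical (α ::ₘ Γ) Δ (by simpa [hα] using hΓ) hΔ.2 <| by
        simp only [Multiset.forall_mem_cons]
        exact fun v hv => (h v hv.2).resolve_left fun hn => hn hv.1
      exact ⟨n + 1, .rneg _ _ _ _ _ hα hn⟩
    | conj α β =>
      obtain ⟨n, hα, hβ⟩ := GT.exists_common_height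
        (complete_of_isClassical Γ (α ::ₘ Δ) hΓ
          (by simp only [Multiset.forall_mem_cons]; exact ⟨hΔ.1.1, hΔ.2⟩) <| by
          simp only [Multiset.mem_cons, exists_eq_or_imp]
          exact fun v hv => (h v hv).imp_left And.left)
        (complete_of_isClassical Γ (β ::ₘ Δ) hΓ
          (by simp only [Multiset.forall_mem_cons]; exact ⟨hΔ.1.2, hΔ.2⟩) <| by
          simp only [Multiset.mem_cons, exists_eq_or_imp]
          exact fun v hv => (h v hv).imp_left And.right)
      exact ⟨n + 1, by simpa using GT.rconj _ _ _ _ 0 _ _ hΔ.2 hα hβ⟩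
    | disj α β =>
      obtain ⟨n, hn⟩ := complete_of_isClassical Γ (α ::ₘ β ::ₘ Δ) hΓ
        (by simp only [Multiset.forall_mem_cons]; exact ⟨hΔ.1.1, hΔ.1.2, hΔ.2⟩) <| by
        simp only [Multiset.mem_cons, exists_eq_or_imp]
        exact fun v hv => or_assoc.mp (h v hv)
      exact ⟨n + 1, .rdisj _ _ _ _ _ _ hn⟩
    | idisj φ ψ => exact hΔ.1.elim
  push Not at hL hR
  classical
  obtain ⟨δ, hδ, hv⟩ := h (fun p => decide (Form.var p ∈ Γ)) fun γ hγ => by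
    obtain ⟨p, rfl⟩ := hL γ hγ
    simpa [Form.CSat] using hγ
  obtain ⟨p, rfl⟩ := hR δ hδ fun hb => by simp [hb, Form.CSat] at hv
  obtain ⟨Γ, rfl⟩ := Multiset.exists_cons_of_mem (of_decide_eq_true hv)
  obtain ⟨Δ, rfl⟩ := Multiset.exists_cons_of_mem hδ
  exact ⟨1, .ax _ _ _ _ _⟩
termination_by msize Γ + msize Δ
decreasing_by all_goals subst_vars; simp only [msize_cons, Form.neg.sizeOf_spec,
  Form.conj.sizeOf_spec, Form.disj.sizeOf_spec]; omega

/-- Cut-free completeness. -/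
theorem GT.complete (Γ Δ : Multiset Form) (hΓ : ∀ φ ∈ Γ, Form.WF φ) (hΔ : ∀ φ ∈ Δ, Form.WF φ)
    (h : SequentValid Γ Δ) : ∃ n, GT false n Γ Δ := by
  by_cases hL : ∃ φ ∈ Γ, ¬ Form.IsClassical φ
  · obtain ⟨φ, hφ, hc⟩ := hL
    obtain ⟨χ, φL, φR, rfl⟩ := (hΓ φ hφ).exists_fill_idisj hc
    obtain ⟨Γ, rfl⟩ := Multiset.exists_cons_of_mem hφ
    rw [Multiset.forall_mem_cons] at hΓ
    have hltL : sizeOf (χ.fill φL) < sizeOf (χ.fill (φL.idisj φR)) :=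
      Form.sizeOf_fill_lt χ (by simp only [Form.idisj.sizeOf_spec]; omega)
    have hltR : sizeOf (χ.fill φR) < sizeOf (χ.fill (φL.idisj φR)) :=
      Form.sizeOf_fill_lt χ (by simp only [Form.idisj.sizeOf_spec]; omega)
    have hwf := Form.wf_fill_idisj hΓ.1
    obtain ⟨n, hn, hn'⟩ := GT.exists_common_height
      (complete (χ.fill φL ::ₘ Γ) Δ (Multiset.forall_mem_cons.mpr ⟨hwf.1, hΓ.2⟩) hΔ
        fun t ht => h t (satAll_cons.mpr
          ((satAll_cons.mp ht).imp_left fun hs => (Form.sat_fill_idisj ..).mpr (Or.inl hs))))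
      (complete (χ.fill φR ::ₘ Γ) Δ (Multiset.forall_mem_cons.mpr ⟨hwf.2, hΓ.2⟩) hΔ
        fun t ht => h t (satAll_cons.mpr
          ((satAll_cons.mp ht).imp_left fun hs => (Form.sat_fill_idisj ..).mpr (Or.inr hs))))
    exact ⟨n + 1, .lidisj _ _ _ _ _ _ _ hn hn'⟩
  push Not at hL
  -- A classical antecedent is satisfied exactly by the subteams of a largest team.
  have hsat (t : Team) : SatAll t Γ ↔ t ⊆ {v | ∀ γ ∈ Γ, Form.CSat γ v} := by
    constructor
    · exact fun ht v hv γ hγ => ((hL γ hγ).sat_iff t).mp (ht γ hγ) v hv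
    · exact fun ht γ hγ => ((hL γ hγ).sat_iff t).mpr fun v hv => ht hv γ hγ
  have hmax := h _ ((hsat _).mpr subset_rfl)
  by_cases hR : ∃ φ ∈ Δ, ¬ Form.IsClassical φ
  · obtain ⟨φ, hφ, hc⟩ := hR
    obtain ⟨χ, φL, φR, rfl⟩ := (hΔ φ hφ).exists_fill_idisj hc
    obtain ⟨Δ, rfl⟩ := Multiset.exists_cons_of_mem hφ
    rw [Multiset.forall_mem_cons] at hΔ
    have hltL : sizeOf (χ.fill φL) < sizeOf (χ.fill (φL.idisj φR)) :=
      Form.sizeOf_fill_lt χ (by simp only [Form.idisj.sizeOf_spec]; omega)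
    have hltR : sizeOf (χ.fill φR) < sizeOf (χ.fill (φL.idisj φR)) :=
      Form.sizeOf_fill_lt χ (by simp only [Form.idisj.sizeOf_spec]; omega)
    have hwf := Form.wf_fill_idisj hΔ.1
    rcases splitSat_fill_idisj.mp hmax with hs | hs
    · obtain ⟨n, hn⟩ := complete Γ (χ.fill φL ::ₘ Δ) hΓ
        (Multiset.forall_mem_cons.mpr ⟨hwf.1, hΔ.2⟩) fun t ht => hs.mono ((hsat t).mp ht)
      exact ⟨n + 1, .ridisjL _ _ _ _ _ _ _ hn⟩
    · obtain ⟨n, hn⟩ := complete Γ (χ.fill φR ::ₘ Δ) hΓ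
        (Multiset.forall_mem_cons.mpr ⟨hwf.2, hΔ.2⟩) fun t ht => hs.mono ((hsat t).mp ht)
      exact ⟨n + 1, .ridisjR _ _ _ _ _ _ _ hn⟩
  push Not at hR
  exact GT.complete_of_isClassical Γ Δ hL hR ((splitSat_iff_of_isClassical hR _).mp hmax)
termination_by msize Γ + msize Δ
decreasing_by all_goals subst_vars; simp only [msize_cons]; omega

/-- Cut elimination for GT: every sequent derivable in GT is
derivable in GT⁻. -/
theorem cut_elimination (Γ Δ : Multiset Form)
    (hΓ : ∀ φ ∈ Γ, Form.WF φ) (hΔ : ∀ φ ∈ Δ, Form.WF φ)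
    (h : ∃ n, GT true n Γ Δ) : ∃ n, GT false n Γ Δ := by
  obtain ⟨n, hn⟩ := h
  exact GT.complete Γ Δ hΓ hΔ hn.sound
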